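/- Let a, b ≥ 2 be integers and n ≥ a(b+1). Let G be an edge coloring of K_n such that every a(b+1)-element subset of vertices spans edges of at least (a(b+1) choose 2) − ba + b + 1 distinct colors. Then for every real number T ≥ b·(2 a^{b+1} n^{b−1})^{1/b}, the number of colors that appear on at least T edges of K_n is less than 2 n^b b^{b+1} a^b / T^b. -/

import Mathlib

open Finset

/-- The set of colors appearing on edges (non-diagonal unordered pairs) with both
endpoints in `S`, for an edge coloring `col` of the complete graph on `Fin n`. -/
def colorsIn {n : ℕ} {α : Type} [DecidableEq α]
    (col : Sym2 (Fin n) → α) (S : Finset (Fin n)) : Finset α :=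
  (S.sym2.filter (fun e => ¬ e.IsDiag)).image col

/-- The number of edges (non-diagonal unordered pairs) of `K_n` assigned color `c`. -/
def edgeCount {n : ℕ} {α : Type} [DecidableEq α]
    (col : Sym2 (Fin n) → α) (c : α) : ℕ :=
  (Finset.univ.filter (fun e : Sym2 (Fin n) => ¬ e.IsDiag ∧ col e = c)).card

/-- The set of edges of color `c`. -/
def edgesOf {n : ℕ} {α : Type} [DecidableEq α] (col : Sym2 (Fin n) → α) (c : α) :
    Finset (Sym2 (Fin n)) :=
  Finset.univ.filter (fun e : Sym2 (Fin n) => ¬ e.IsDiag ∧ col e = c)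

/-- The set of smaller endpoints of edges of color `c`. -/
def lowSet {n : ℕ} {α : Type} [DecidableEq α] (col : Sym2 (Fin n) → α) (c : α) :
    Finset (Fin n) := (edgesOf col c).image Sym2.inf

lemma card_edges_in {n : ℕ} (S : Finset (Fin n)) :
    (S.sym2.filter (fun e => ¬ e.IsDiag)).card = S.card.choose 2 := by
  rw [← Sym2.card_image_offDiag]
  congr 1
  ext e
  induction e with | _ x y
  simp only [mem_filter, mk_mem_sym2_iff, mem_image, mem_offDiag, Prod.exists,
    Function.uncurry_apply_pair, Sym2.mk_isDiag_iff]
  constructor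
  · rintro ⟨⟨hx, hy⟩, h⟩
    exact ⟨x, y, ⟨hx, hy, h⟩, rfl⟩
  · rintro ⟨u, v, ⟨hu, hv, h⟩, he⟩
    rcases Sym2.eq_iff.mp he with ⟨rfl, rfl⟩ | ⟨rfl, rfl⟩
    · exact ⟨⟨hu, hv⟩, h⟩
    · exact ⟨⟨hv, hu⟩, fun h' => h h'.symm⟩

lemma repetition_bound {a b n : ℕ} (ha : 2 ≤ a) (hb : 2 ≤ b) (hn : a * (b + 1) ≤ n)
    {α : Type} [DecidableEq α] (col : Sym2 (Fin n) → α)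
    (hlocal : ∀ S : Finset (Fin n), S.card = a * (b + 1) →
      (a * (b + 1)).choose 2 - b * a + b + 1 ≤ (colorsIn col S).card)
    (E : Finset (Sym2 (Fin n))) (S : Finset (Fin n)) (hS : S.card ≤ a * (b + 1))
    (hE : ∀ e ∈ E, ¬ e.IsDiag ∧ e ∈ S.sym2) :
    E.card + b + 1 ≤ (E.image col).card + b * a := by
  obtain ⟨S', hSS', hS'⟩ := Finset.exists_superset_card_eq hS (by simpa using hn)
  have h := hlocal S' hS'
  have hF := card_edges_in S'
  rw [hS'] at hF
  unfold colorsIn at h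
  set F := S'.sym2.filter (fun e => ¬ e.IsDiag) with hFdef
  have hEF : E ⊆ F := by
    intro e he
    exact mem_filter.mpr ⟨sym2_mono hSS' (hE e he).2, (hE e he).1⟩
  have h1 : (F.image col).card ≤ (E.image col).card + ((F \ E).image col).card := by
    rw [← union_sdiff_of_subset hEF, image_union]
    refine (card_union_le _ _).trans ?_
    rw [union_sdiff_of_subset hEF]
  have h2 : ((F \ E).image col).card ≤ (F \ E).card := card_image_le
  have h3 := card_sdiff_add_card_eq_card hEF
  omega

lemma degree_bound {a b n : ℕ} (ha : 2 ≤ a) (hb : 2 ≤ b) (hn : a * (b + 1) ≤ n)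
    {α : Type} [DecidableEq α] (col : Sym2 (Fin n) → α)
    (hlocal : ∀ S : Finset (Fin n), S.card = a * (b + 1) →
      (a * (b + 1)).choose 2 - b * a + b + 1 ≤ (colorsIn col S).card)
    (c : α) (v : Fin n) :
    ((edgesOf col c).filter (fun e => v ∈ e)).card ≤ b * a := by
  by_contra hcon
  have hba : b ≤ b * a := Nat.le_mul_of_pos_right _ (by omega)
  obtain ⟨E, hEs, hEc⟩ := exists_subset_card_eq
    (show b * a - b + 1 ≤ ((edgesOf col c).filter (fun e => v ∈ e)).card by omega)
  have hmem : ∀ e ∈ E, (¬ e.IsDiag ∧ col e = c) ∧ v ∈ e := by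
    intro e he
    simpa [edgesOf] using hEs he
  have hcard : (insert v (E.biUnion (fun e => e.toFinset.erase v))).card ≤ E.card * 1 + 1 := by
    refine (card_insert_le _ _).trans ?_
    gcongr
    refine card_biUnion_le_card_mul _ _ _ ?_
    intro e he
    rw [card_erase_of_mem (Sym2.mem_toFinset.mpr (hmem e he).2),
      Sym2.card_toFinset_of_not_isDiag e (hmem e he).1.1]
  have h := repetition_bound ha hb hn col hlocal E
    (insert v (E.biUnion (fun e => e.toFinset.erase v))) (by
      rw [mul_add, mul_one, mul_comm a b]; omega) (by
      intro e he
      refine ⟨(hmem e he).1.1, ?_⟩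
      rw [mem_sym2_iff]
      intro x hx
      by_cases hxv : x = v
      · simp [hxv]
      · refine mem_insert_of_mem (mem_biUnion.mpr ⟨e, he, ?_⟩)
        exact mem_erase.mpr ⟨hxv, Sym2.mem_toFinset.mpr hx⟩)
  have himg : (E.image col).card ≤ 1 := by
    rw [card_le_one]
    intro x hx y hy
    obtain ⟨e, he, rfl⟩ := mem_image.mp hx
    obtain ⟨e', he', rfl⟩ := mem_image.mp hy
    rw [(hmem e he).1.2, (hmem e' he').1.2]
  omega

lemma inf_mem' {n : ℕ} (e : Sym2 (Fin n)) : e.inf ∈ e := by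
  induction e with | _ x y
  rcases le_total x y with h | h <;> simp [h]

lemma mem_inf_or_sup {n : ℕ} (e : Sym2 (Fin n)) (x : Fin n) (hx : x ∈ e) :
    x = e.inf ∨ x = e.sup := by
  induction e with | _ y z
  rcases le_total y z with h | h <;> rcases Sym2.mem_iff.mp hx with rfl | rfl <;> simp [h]

lemma star_bound {a b n : ℕ} (ha : 2 ≤ a) (hb : 2 ≤ b) (hn : a * (b + 1) ≤ n)
    {α : Type} [DecidableEq α] (col : Sym2 (Fin n) → α)
    (hlocal : ∀ S : Finset (Fin n), S.card = a * (b + 1) →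
      (a * (b + 1)).choose 2 - b * a + b + 1 ≤ (colorsIn col S).card)
    (P : Finset α) (hP : P.card = b) :
    (univ.filter (fun v => ∀ c ∈ P, v ∈ lowSet col c)).card ≤ a - 1 := by
  by_contra hcon
  obtain ⟨W, hWs, hWc⟩ := exists_subset_card_eq
    (show a ≤ (univ.filter (fun v => ∀ c ∈ P, v ∈ lowSet col c)).card by omega)
  have hW : ∀ p : α × Fin n, ∃ e : Sym2 (Fin n), p ∈ P ×ˢ W →
      (¬ e.IsDiag ∧ col e = p.1) ∧ e.inf = p.2 := by
    rintro ⟨c, w⟩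
    by_cases hp : (c, w) ∈ P ×ˢ W
    · rw [mem_product] at hp
      have h := (mem_filter.mp (hWs hp.2)).2 c hp.1
      obtain ⟨e, he, hew⟩ := mem_image.mp h
      exact ⟨e, fun _ => ⟨by simpa [edgesOf] using he, hew⟩⟩
    · exact ⟨s(w, w), fun h => absurd h hp⟩
  choose f hf using hW
  have hinj : Set.InjOn f (P ×ˢ W : Finset (α × Fin n)) := by
    intro p hp q hq hpq
    have h1 := hf p hp
    have h2 := hf q hq
    rw [hpq] at h1
    exact Prod.ext (h1.1.2.symm.trans h2.1.2) (h1.2.symm.trans h2.2)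
  have hEc : ((P ×ˢ W).image f).card = b * a := by
    rw [card_image_of_injOn hinj, card_product, hP, hWc]
  have h := repetition_bound ha hb hn col hlocal ((P ×ˢ W).image f)
    (W ∪ ((P ×ˢ W).image f).image Sym2.sup) (by
      refine (card_union_le _ _).trans ?_
      have : (((P ×ˢ W).image f).image Sym2.sup).card ≤ b * a := hEc ▸ card_image_le
      rw [mul_add, mul_one, mul_comm a b]; omega) (by
      intro e he
      obtain ⟨p, hp, rfl⟩ := mem_image.mp he
      refine ⟨(hf p hp).1.1, ?_⟩
      rw [mem_sym2_iff]
      intro x hx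
      rcases mem_inf_or_sup _ x hx with rfl | rfl
      · rw [(hf p hp).2]
        exact mem_union_left _ (mem_product.mp hp).2
      · exact mem_union_right _ (mem_image_of_mem _ he))
  have himg : (((P ×ˢ W).image f).image col).card ≤ b := by
    rw [← hP]
    apply card_le_card
    intro x hx
    obtain ⟨e, he, rfl⟩ := mem_image.mp hx
    obtain ⟨p, hp, rfl⟩ := mem_image.mp he
    rw [(hf p hp).1.2]
    exact (mem_product.mp hp).1
  omega

lemma analytic (a b n m : ℕ) (ha : 2 ≤ a) (hb : 2 ≤ b) (hn : 0 < n) (s : ℝ)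
    (d : Fin n → ℕ) (hs0 : 0 < s) (hs : 2 * s ≤ n)
    (hsb : 2 * (a : ℝ) * (n : ℝ) ^ (b - 1) ≤ s ^ b)
    (hm : 2 * (b : ℝ) * (n : ℝ) ^ b ≤ m * s ^ b)
    (hd : (m : ℝ) * s ≤ ∑ v, (d v : ℝ))
    (hc : ∑ v, (d v).choose b ≤ m.choose b * (a - 1)) : False := by
  obtain ⟨k, rfl⟩ : ∃ k, b = k + 1 := ⟨b - 1, by omega⟩
  simp only [Nat.add_sub_cancel] at hsb
  have hn' : (0 : ℝ) < n := by exact_mod_cast hn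
  set Q : ℝ := m * s with hQ
  have h1 : 2 * ((k + 1 : ℕ) : ℝ) * n * 2 ^ k ≤ Q := by
    have hsk : 0 < s ^ k := by positivity
    refine le_of_mul_le_mul_right ?_ hsk
    calc 2 * ((k + 1 : ℕ) : ℝ) * n * 2 ^ k * s ^ k
        = 2 * ((k + 1 : ℕ) : ℝ) * n * (2 * s) ^ k := by rw [mul_pow]; ring
      _ ≤ 2 * ((k + 1 : ℕ) : ℝ) * n * (n : ℝ) ^ k := by gcongr
      _ = 2 * ((k + 1 : ℕ) : ℝ) * (n : ℝ) ^ (k + 1) := by ring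
      _ ≤ m * s ^ (k + 1) := hm
      _ = Q * s ^ k := by rw [hQ]; ring
  have hQ0 : 0 < Q := lt_of_lt_of_le (by positivity) h1
  have hm0 : (0 : ℝ) < m := by
    by_contra h
    have : Q ≤ 0 := mul_nonpos_of_nonpos_of_nonneg (not_lt.mp h) hs0.le
    linarith
  have hk2 : (k : ℝ) ≤ 2 ^ k := by exact_mod_cast (Nat.lt_two_pow_self (n := k)).le
  have hx : ((k + 1 : ℕ) : ℝ) * (n * k / Q) ≤ 1 / 2 := by
    rw [← mul_div_assoc, div_le_iff₀ hQ0]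
    have : ((k + 1 : ℕ) : ℝ) * n * k ≤ ((k + 1 : ℕ) : ℝ) * n * 2 ^ k := by gcongr
    linarith
  have hx0 : 0 ≤ (n * k / Q : ℝ) := by positivity
  have hk1 : (1 : ℝ) ≤ ((k + 1 : ℕ) : ℝ) := by push_cast; linarith [Nat.cast_nonneg (α := ℝ) k]
  have hx1 : (n * k / Q : ℝ) ≤ 1 / 2 := by nlinarith
  have hbern := one_add_mul_le_pow (a := -(n * k / Q : ℝ)) (by linarith) (k + 1)
  have h2 : Q ^ (k + 1) / 2 ≤ (Q - n * k) ^ (k + 1) := by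
    have e : Q - n * k = Q * (1 + -(n * k / Q)) := by field_simp; ring
    rw [e, mul_pow Q]
    have : (1 : ℝ) / 2 ≤ (1 + -(n * k / Q)) ^ (k + 1) := by linarith
    calc Q ^ (k + 1) / 2 = Q ^ (k + 1) * (1 / 2) := by ring
      _ ≤ _ := by gcongr
  have h3 : Q - n * k ≤ ∑ v, ((d v + 1 - (k + 1) : ℕ) : ℝ) := by
    have : ∑ v, ((d v : ℝ) - k) ≤ ∑ v, ((d v + 1 - (k + 1) : ℕ) : ℝ) := by
      apply sum_le_sum
      intro v _
      have : d v ≤ (d v + 1 - (k + 1)) + k := by omega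
      have : (d v : ℝ) ≤ ((d v + 1 - (k + 1) : ℕ) : ℝ) + k := by exact_mod_cast this
      linarith
    rw [sum_sub_distrib] at this
    simp only [sum_const, card_univ, Fintype.card_fin, nsmul_eq_mul] at this
    linarith
  have hQn : 0 ≤ Q - n * k := by
    rw [div_le_iff₀ hQ0] at hx1
    linarith
  have h4 := pow_sum_div_card_le_sum_pow (s := (univ : Finset (Fin n)))
    (f := fun v => ((d v + 1 - (k + 1) : ℕ) : ℝ)) (fun i _ => by positivity) k
  simp only [card_univ, Fintype.card_fin] at h4
  have h5 : ∑ v, (d v + 1 - (k + 1)) ^ (k + 1) ≤ m ^ (k + 1) * (a - 1) := by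
    calc ∑ v, (d v + 1 - (k + 1)) ^ (k + 1)
        ≤ ∑ v, (k + 1).factorial * (d v).choose (k + 1) := by
          apply sum_le_sum
          intro v _
          rw [← Nat.descFactorial_eq_factorial_mul_choose]
          exact Nat.pow_sub_le_descFactorial _ _
      _ = (k + 1).factorial * ∑ v, (d v).choose (k + 1) := by rw [mul_sum]
      _ ≤ (k + 1).factorial * (m.choose (k + 1) * (a - 1)) := by gcongr
      _ = m.descFactorial (k + 1) * (a - 1) := by
          rw [Nat.descFactorial_eq_factorial_mul_choose, mul_assoc]
      _ ≤ _ := by gcongr; exact Nat.descFactorial_le_pow _ _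
  have h5' : ∑ v, ((d v + 1 - (k + 1) : ℕ) : ℝ) ^ (k + 1) ≤ (m : ℝ) ^ (k + 1) * ((a : ℝ) - 1) := by
    have : ((∑ v, (d v + 1 - (k + 1)) ^ (k + 1) : ℕ) : ℝ) ≤ ((m ^ (k + 1) * (a - 1) : ℕ) : ℝ) := by
      exact_mod_cast h5
    rw [Nat.cast_mul, Nat.cast_sub (by omega : 1 ≤ a)] at this
    simpa only [Nat.cast_sum, Nat.cast_pow, Nat.cast_one] using this
  have h6 : (Q - n * k) ^ (k + 1) ≤ (∑ v, ((d v + 1 - (k + 1) : ℕ) : ℝ)) ^ (k + 1) := by gcongr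
  have h7 := h4.trans h5'
  rw [div_le_iff₀ (by positivity)] at h7
  have h8 : (m : ℝ) ^ (k + 1) * (2 * a * (n : ℝ) ^ k) ≤ Q ^ (k + 1) := by
    rw [hQ, mul_pow]; gcongr
  have h9 : 0 < (m : ℝ) ^ (k + 1) * (n : ℝ) ^ k := by positivity
  nlinarith

/-- Let `a, b ≥ 2` and `n ≥ a(b+1)`. In every edge coloring of `K_n` in which every
`a(b+1)`-element vertex subset spans at least `(a(b+1) choose 2) - ba + b + 1` distinct
colors, for every real `T ≥ b (2 a^(b+1) n^(b-1))^(1/b)`, the number of colors appearing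
on at least `T` edges is less than `2 n^b b^(b+1) a^b / T^b`. -/
theorem stmt14 (a b n : ℕ) (ha : 2 ≤ a) (hb : 2 ≤ b) (hn : a * (b + 1) ≤ n)
    (α : Type) [DecidableEq α] (col : Sym2 (Fin n) → α)
    (hlocal : ∀ S : Finset (Fin n), S.card = a * (b + 1) →
      (a * (b + 1)).choose 2 - b * a + b + 1 ≤ (colorsIn col S).card) :
    ∀ T : ℝ, (b : ℝ) * (2 * (a : ℝ) ^ (b + 1) * (n : ℝ) ^ (b - 1)) ^ ((1 : ℝ) / (b : ℝ)) ≤ T →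
      (((colorsIn col Finset.univ).filter
          (fun c => T ≤ (edgeCount col c : ℝ))).card : ℝ)
        < 2 * (n : ℝ) ^ b * (b : ℝ) ^ (b + 1) * (a : ℝ) ^ b / T ^ b := by
  intro T hT
  by_contra hcon
  rw [not_lt] at hcon
  have ha' : (0 : ℝ) < a := by exact_mod_cast (by omega : 0 < a)
  have hb' : (0 : ℝ) < b := by exact_mod_cast (by omega : 0 < b)
  have hn0 : 0 < n := lt_of_lt_of_le (by positivity) hn
  have hn' : (0 : ℝ) < n := by exact_mod_cast hn0
  have hX : (0 : ℝ) < 2 * (a : ℝ) ^ (b + 1) * (n : ℝ) ^ (b - 1) := by positivity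
  have hT0 : 0 < T := lt_of_lt_of_le (by positivity) hT
  have hTb : (b : ℝ) ^ b * (2 * (a : ℝ) ^ (b + 1) * (n : ℝ) ^ (b - 1)) ≤ T ^ b := by
    have h := pow_le_pow_left₀ (by positivity) hT b
    rwa [mul_pow, one_div, Real.rpow_inv_natCast_pow hX.le (by omega)] at h
  set M := (colorsIn col Finset.univ).filter (fun c => T ≤ (edgeCount col c : ℝ)) with hM
  have hdeg := degree_bound ha hb hn col hlocal
  have hlow : ∀ c ∈ M, T / (a * b) ≤ ((lowSet col c).card : ℝ) := by
    intro c hc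
    have h1 : T ≤ (edgeCount col c : ℝ) := (mem_filter.mp hc).2
    have h2 : (edgesOf col c).card ≤ (b * a) * (lowSet col c).card := by
      refine card_le_mul_card_image _ _ ?_
      intro v _
      refine le_trans (card_le_card ?_) (hdeg c v)
      intro e he
      rw [mem_filter] at he ⊢
      exact ⟨he.1, he.2 ▸ inf_mem' e⟩
    have h3 : (edgeCount col c : ℝ) ≤ (b * a) * (lowSet col c).card := by exact_mod_cast h2
    rw [div_le_iff₀ (by positivity)]
    linarith
  have hMpos : 0 < (M.card : ℝ) := lt_of_lt_of_le (by positivity) hcon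
  obtain ⟨c₀, hc₀⟩ : M.Nonempty := card_pos.mp (by exact_mod_cast hMpos)
  have hs : 2 * (T / (a * b)) ≤ n := by
    have h1 : T ≤ (edgeCount col c₀ : ℝ) := (mem_filter.mp hc₀).2
    have h2 := sum_card_bipartiteAbove_eq_sum_card_bipartiteBelow
      (s := (univ : Finset (Fin n))) (t := edgesOf col c₀) (fun v e => v ∈ e)
    have h3 : ∑ e ∈ edgesOf col c₀, ((univ : Finset (Fin n)).bipartiteBelow
        (fun v e => v ∈ e) e).card = (edgesOf col c₀).card * 2 := by
      refine sum_const_nat ?_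
      intro e he
      rw [← Sym2.card_toFinset_of_not_isDiag e (mem_filter.mp he).2.1]
      congr 1
      ext x
      simp [bipartiteBelow]
    have h4 : ∑ v : Fin n, ((edgesOf col c₀).bipartiteAbove (fun v e => v ∈ e) v).card
        ≤ n * (b * a) := by
      refine (sum_le_card_nsmul _ _ (b * a) (fun v _ => hdeg c₀ v)).trans ?_
      simp
    have h5 : (edgesOf col c₀).card * 2 ≤ n * (b * a) := by omega
    have h6 : (edgeCount col c₀ : ℝ) * 2 ≤ n * (b * a) := by exact_mod_cast h5
    rw [← mul_div_assoc, div_le_iff₀ (by positivity)]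
    linarith
  refine analytic a b n M.card ha hb hn0 (T / (a * b))
    (fun v => (M.filter (fun c => v ∈ lowSet col c)).card) (by positivity) hs ?_ ?_ ?_ ?_
  · rw [div_pow, le_div_iff₀ (by positivity)]
    calc _ = (b : ℝ) ^ b * (2 * (a : ℝ) ^ (b + 1) * (n : ℝ) ^ (b - 1)) := by
          rw [mul_pow]; ring
      _ ≤ _ := hTb
  · rw [div_le_iff₀ (by positivity)] at hcon
    rw [div_pow, ← mul_div_assoc, le_div_iff₀ (by positivity)]
    calc _ = 2 * (n : ℝ) ^ b * (b : ℝ) ^ (b + 1) * (a : ℝ) ^ b := by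
          rw [mul_pow]; ring
      _ ≤ _ := hcon
  · have h := sum_card_bipartiteAbove_eq_sum_card_bipartiteBelow
      (s := (univ : Finset (Fin n))) (t := M) (fun v c => v ∈ lowSet col c)
    have h1 : ∑ v : Fin n, ((M.filter (fun c => v ∈ lowSet col c)).card : ℝ)
        = ∑ c ∈ M, ((lowSet col c).card : ℝ) := by
      have h2 : ∑ v : Fin n, (M.filter (fun c => v ∈ lowSet col c)).card
          = ∑ c ∈ M, (lowSet col c).card := by
        refine Eq.trans h ?_
        refine sum_congr rfl fun c _ => ?_
        congr 1
        ext x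
        simp [bipartiteBelow]
      exact_mod_cast h2
    rw [h1, ← nsmul_eq_mul]
    exact card_nsmul_le_sum _ _ _ hlow
  · have h := sum_card_bipartiteAbove_eq_sum_card_bipartiteBelow
      (s := (univ : Finset (Fin n))) (t := M.powersetCard b)
      (fun v P => ∀ c ∈ P, v ∈ lowSet col c)
    have h1 : ∑ v : Fin n, ((M.filter (fun c => v ∈ lowSet col c)).card).choose b
        = ∑ v : Fin n, ((M.powersetCard b).bipartiteAbove
          (fun v P => ∀ c ∈ P, v ∈ lowSet col c) v).card := by
      refine sum_congr rfl fun v _ => ?_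
      rw [← card_powersetCard]
      congr 1
      ext P
      simp only [bipartiteAbove, mem_powersetCard, mem_filter, subset_iff]
      constructor
      · rintro ⟨h, h'⟩
        exact ⟨⟨fun x hx => (h hx).1, h'⟩, fun x hx => (h hx).2⟩
      · rintro ⟨⟨h, h'⟩, h''⟩
        exact ⟨fun x hx => ⟨h hx, h'' x hx⟩, h'⟩
    rw [h1, h, ← card_powersetCard, ← smul_eq_mul]
    refine sum_le_card_nsmul _ _ _ fun P hP => ?_
    exact star_bound ha hb hn col hlocal P (mem_powersetCard.mp hP).2
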